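/- arXiv:0808.1657 — 2 statements merged into one kernel-verified Lean document; each statement's English description precedes it below -/
import Mathlib

section
/- Let k ≥ 2 and let x be an irrational real number whose continued fraction expansion [a_0, a_1, a_2, …] is k-automatic (in particular, the partial quotients are bounded). Let T be the Gauss-type map T(y) = 1/(y − ⌊y⌋), so that T([a_0, a_1, a_2, …]) = [a_1, a_2, …]. Then the continued fraction expansions of both liminf_{n→∞} T^n(x) and limsup_{n→∞} T^n(x) are k-automatic. -/
/-- Lexicographic order on infinite sequences over a linearly ordered
alphabet: `x ≤ y` iff `x = y` or `x` and `y` agree before some position `n`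
and `x n < y n`. -/
def SeqLexLe {Δ : Type*} [LinearOrder Δ] (x y : ℕ → Δ) : Prop :=
  x = y ∨ ∃ n : ℕ, (∀ m : ℕ, m < n → x m = y m) ∧ x n < y n

/-- `b` lies in the orbit closure of `a`: every finite prefix of `b` is a
factor of `a`. -/
def InOrbitClosure {Δ : Type*} (a b : ℕ → Δ) : Prop :=
  ∀ n : ℕ, ∃ i : ℕ, ∀ m : ℕ, m < n → b m = a (i + m)

/-- `a` is a `k`-automatic sequence: there is a DFAO (finite state set `Fin n`,
transition `δ`, initial state `q0`, output `τ`) which, on every base-`k`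
representation of `m` read least significant digit first (i.e. on `w^R`,
possibly with leading zeros in `w`), outputs `a m`. -/
def IsKAutomatic (k : ℕ) {Δ : Type*} (a : ℕ → Δ) : Prop :=
  ∃ (n : ℕ) (δ : Fin n → Fin k → Fin n) (q0 : Fin n) (τ : Fin n → Δ),
    ∀ (m : ℕ) (w : List (Fin k)),
      Nat.ofDigits k (w.map Fin.val) = m → a m = τ (w.foldl δ q0)

/-- The Gauss-type map on continued fractions: `T(y) = 1/(y - ⌊y⌋)`, so that
`T [a₀; a₁, a₂, …] = [a₁; a₂, …]`. -/
noncomputable def gaussMap (y : ℝ) : ℝ :=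
  1 / (y - ↑⌊y⌋)

/-- The sequence of partial quotients of the continued fraction expansion of
`x`: `cfSeq x n = aₙ` where `x = [a₀; a₁, a₂, …]`. -/
noncomputable def cfSeq (x : ℝ) (n : ℕ) : ℤ :=
  ⌊gaussMap^[n] x⌋

/-- A function of countably many natural variables has finite `k`-kernel if it lies in a finite
family closed under the substitutions `v ↦ k * v + r` for digit vectors `r`. -/
def FiniteKernel (k : ℕ) {β : Type*} (f : (ℕ → ℕ) → β) : Prop :=
  ∃ K : Set ((ℕ → ℕ) → β), K.Finite ∧ f ∈ K ∧
    ∀ g ∈ K, ∀ r : ℕ → Fin k, (fun v => g (fun i => k * v i + r i)) ∈ K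

/-- The assignment obtained from `v` by inserting the value `y` in front. -/
def consAssign (y : ℕ) (v : ℕ → ℕ) : ℕ → ℕ
  | 0 => y
  | i + 1 => v i

namespace FiniteKernel

variable {k : ℕ} {β γ ε : Type*}

theorem map {f : (ℕ → ℕ) → β} (F : β → γ) (hf : FiniteKernel k f) :
    FiniteKernel k (fun v => F (f v)) := by
  obtain ⟨K, hK, hfK, hs⟩ := hf
  refine ⟨(fun g v => F (g v)) '' K, hK.image _, ⟨f, hfK, rfl⟩, ?_⟩
  rintro _ ⟨g, hg, rfl⟩ r
  exact ⟨_, hs g hg r, rfl⟩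

theorem map₂ {f : (ℕ → ℕ) → β} {g : (ℕ → ℕ) → γ} (F : β → γ → ε)
    (hf : FiniteKernel k f) (hg : FiniteKernel k g) :
    FiniteKernel k (fun v => F (f v) (g v)) := by
  obtain ⟨K, hK, hfK, hs⟩ := hf
  obtain ⟨L, hL, hgL, ht⟩ := hg
  refine ⟨Set.image2 (fun f g v => F (f v) (g v)) K L, hK.image2 _ hL, ⟨f, hfK, g, hgL, rfl⟩, ?_⟩
  rintro _ ⟨f', hf', g', hg', rfl⟩ r
  exact ⟨_, hs f' hf' r, _, ht g' hg' r, rfl⟩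

/-- Projecting out the first variable, collecting all values attained. -/
theorem range_cons {f : (ℕ → ℕ) → β} (hk : 0 < k) (hf : FiniteKernel k f) :
    FiniteKernel k (fun v => Set.range (fun y => f (consAssign y v))) := by
  obtain ⟨K, hK, hfK, hs⟩ := hf
  refine ⟨(fun (F : Set ((ℕ → ℕ) → β)) v => {c | ∃ g ∈ F, ∃ y, g (consAssign y v) = c}) ''
    {F | F ⊆ K}, hK.finite_subsets.image _, ⟨{f}, by simpa using hfK, ?_⟩, ?_⟩
  · funext v
    ext c
    simp
  rintro _ ⟨F, hF, rfl⟩ r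
  let digits (s : Fin k) : ℕ → Fin k := fun i => Nat.casesOn i s r
  have hcons (v : ℕ → ℕ) (y : ℕ) (s : Fin k) :
      (fun i => k * consAssign y v i + (digits s i).val) =
        consAssign (k * y + s) (fun i => k * v i + r i) := by
    funext i
    cases i <;> rfl
  refine ⟨{h | ∃ g ∈ F, ∃ s : Fin k, h = fun v => g (fun i => k * v i + (digits s i).val)}, ?_, ?_⟩
  · rintro _ ⟨g, hg, s, rfl⟩
    exact hs g (hF hg) _
  · funext v
    ext c
    constructor
    · rintro ⟨_, ⟨g, hg, s, rfl⟩, y, rfl⟩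
      exact ⟨g, hg, k * y + s, congrArg g (hcons v y s).symm⟩
    · rintro ⟨g, hg, y, rfl⟩
      refine ⟨_, ⟨g, hg, ⟨y % k, Nat.mod_lt _ hk⟩, rfl⟩, y / k, ?_⟩
      simp only [hcons, Nat.div_add_mod]

theorem exists_first {P : (ℕ → ℕ) → ℕ → Prop} (hk : 0 < k)
    (hP : FiniteKernel k (fun v => P (fun i => v (i + 1)) (v 0))) :
    FiniteKernel k (fun v => ∃ y, P v y) := by
  convert (hP.range_cons hk).map (fun S : Set Prop => True ∈ S) using 3 with v
  simp [consAssign]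

theorem forall_first {P : (ℕ → ℕ) → ℕ → Prop} (hk : 0 < k)
    (hP : FiniteKernel k (fun v => P (fun i => v (i + 1)) (v 0))) :
    FiniteKernel k (fun v => ∀ y, P v y) := by
  convert (exists_first (P := fun v y => ¬ P v y) hk (hP.map Not)).map Not using 3 with v
  simp

theorem lt_or_le (b : Bool) (i j : ℕ) :
    FiniteKernel k (fun v => if b then v i < v j else v i ≤ v j) := by
  refine ⟨Set.range (fun (b : Bool) v => if b then v i < v j else v i ≤ v j),
    Set.finite_range _, ⟨b, rfl⟩, ?_⟩
  have key (x y r s : ℕ) (hr : r < k) (hs : s < k) :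
      (k * x + r < k * y + s ↔ if s ≤ r then x < y else x ≤ y) := by
    split_ifs with h
    · constructor
      · intro h'
        by_contra! hc
        have := Nat.mul_le_mul_left k hc
        omega
      · intro h'
        have := Nat.mul_le_mul_left k (Nat.succ_le_of_lt h')
        rw [Nat.mul_succ] at this
        omega
    · constructor
      · intro h'
        by_contra! hc
        have := Nat.mul_le_mul_left k (Nat.succ_le_of_lt hc)
        rw [Nat.mul_succ] at this
        omega
      · intro h'
        have := Nat.mul_le_mul_left k h'
        omega
  rintro _ ⟨b, rfl⟩ r
  cases b
  · refine ⟨decide (¬ (r i : ℕ) ≤ r j), ?_⟩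
    funext v
    have := key (v j) (v i) (r j) (r i) (r j).2 (r i).2
    by_cases h : (r i : ℕ) ≤ r j
    · rw [if_pos h] at this
      simp only [h, not_true_eq_false, decide_false, Bool.false_eq_true, if_false, eq_iff_iff]
      omega
    · rw [if_neg h] at this
      simp only [h, not_false_eq_true, decide_true, Bool.false_eq_true, if_false, if_true,
        eq_iff_iff]
      omega
  · refine ⟨decide ((r j : ℕ) ≤ r i), ?_⟩
    funext v
    have := key (v i) (v j) (r i) (r j) (r i).2 (r j).2
    by_cases h : (r j : ℕ) ≤ r i <;> simp [h] at this ⊢ <;> exact this.symm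

theorem lt (i j : ℕ) : FiniteKernel k (fun v => v i < v j) := by
  simpa using lt_or_le (k := k) true i j

theorem le (i j : ℕ) : FiniteKernel k (fun v => v i ≤ v j) := by
  simpa using lt_or_le (k := k) false i j

theorem mod_two (i : ℕ) : FiniteKernel k (fun v => v i % 2) := by
  refine ⟨(fun p v => (p.1 * v i + p.2) % 2) '' (Set.Iio (2 : ℕ) ×ˢ Set.Iio (2 : ℕ)),
    ((Set.finite_Iio _).prod (Set.finite_Iio _)).image _, ⟨(1, 0), by simp, by simp⟩, ?_⟩
  rintro _ ⟨⟨c, d⟩, -, rfl⟩ r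
  refine ⟨(c * k % 2, (c * r i + d) % 2), ⟨Nat.mod_lt _ two_pos, Nat.mod_lt _ two_pos⟩, ?_⟩
  funext v
  have : c * (k * v i + r i) + d = c * k * v i + (c * r i + d) := by ring
  simp only [this]
  simp [Nat.add_mod, Nat.mul_mod]

end FiniteKernel

theorem exists_ofDigits_map_val_eq {k : ℕ} (hk : 2 ≤ k) (n : ℕ) :
    ∃ w : List (Fin k), Nat.ofDigits k (w.map Fin.val) = n := by
  refine ⟨(Nat.digits k n).pmap (fun d hd => (⟨d, hd⟩ : Fin k))
    (fun d hd => Nat.digits_lt_base hk hd), ?_⟩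
  rw [List.map_pmap]
  simp [Nat.ofDigits_digits]

theorem IsKAutomatic.finite_range {k : ℕ} (hk : 2 ≤ k) {Δ : Type*} {a : ℕ → Δ}
    (ha : IsKAutomatic k a) : (Set.range a).Finite := by
  obtain ⟨N, δ, q0, τ, h⟩ := ha
  refine (Set.finite_range τ).subset ?_
  rintro _ ⟨n, rfl⟩
  obtain ⟨w, hw⟩ := exists_ofDigits_map_val_eq hk n
  exact ⟨_, (h n w hw).symm⟩

theorem IsKAutomatic.exists_finite_kernel {k : ℕ} (hk : 2 ≤ k) {Δ : Type*} {a : ℕ → Δ}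
    (ha : IsKAutomatic k a) :
    ∃ K : Set (ℕ → Δ), K.Finite ∧ a ∈ K ∧ ∀ g ∈ K, ∀ r < k, (fun n => g (k * n + r)) ∈ K := by
  obtain ⟨N, δ, q0, τ, h⟩ := ha
  choose rep hrep using exists_ofDigits_map_val_eq hk
  refine ⟨Set.range (fun (u : List (Fin k)) n =>
    a (Nat.ofDigits k (u.map Fin.val) + k ^ u.length * n)), ?_, ⟨[], by simp⟩, ?_⟩
  · refine (Set.finite_range (fun q n => τ ((rep n).foldl δ q))).subset ?_
    rintro _ ⟨u, rfl⟩
    refine ⟨u.foldl δ q0, ?_⟩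
    funext n
    dsimp only
    rw [h _ (u ++ rep n) (by simp [Nat.ofDigits_append, hrep]), List.foldl_append]
  · rintro _ ⟨u, rfl⟩ r hr
    refine ⟨u ++ [⟨r, hr⟩], ?_⟩
    funext n
    simp only [List.map_append, List.map_cons, List.map_nil, Nat.ofDigits_append,
      Nat.ofDigits_singleton, List.length_append, List.length_map, List.length_cons,
      List.length_nil]
    congr 1
    ring

theorem IsKAutomatic.finiteKernel_add {k : ℕ} (hk : 2 ≤ k) {Δ : Type*} {a : ℕ → Δ}
    (ha : IsKAutomatic k a) (i j : ℕ) : FiniteKernel k (fun v => a (v i + v j)) := by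
  obtain ⟨K, hK, haK, hs⟩ := ha.exists_finite_kernel hk
  refine ⟨Set.image2 (fun g c v => g (v i + v j + c)) K (Set.Iio 2),
    hK.image2 _ (Set.finite_Iio _), ⟨a, haK, 0, by simp, by simp⟩, ?_⟩
  rintro _ ⟨g, hg, c, hc, rfl⟩ r
  have hi := (r i).2
  have hj := (r j).2
  have hc' : c < 2 := hc
  refine ⟨_, hs g hg ((r i + r j + c) % k) (Nat.mod_lt _ (by omega)), (r i + r j + c) / k, ?_, ?_⟩
  · exact (Nat.div_lt_iff_lt_mul (by omega)).2 (by omega)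
  · funext v
    have h := Nat.div_add_mod (r i + r j + c : ℕ) k
    dsimp only
    congr 1
    rw [mul_add, mul_add, add_assoc, h]
    ring

theorem FiniteKernel.isKAutomatic {k : ℕ} {Δ : Type*} {b : ℕ → Δ}
    (hb : FiniteKernel k (fun v => b (v 0))) : IsKAutomatic k b := by
  obtain ⟨K, hK, hbK, hs⟩ := hb
  have := hK.to_subtype
  obtain ⟨n, ⟨e⟩⟩ := Finite.exists_equiv_fin K
  let step (g : K) (d : Fin k) : K := ⟨_, hs g.1 g.2 (fun _ => d)⟩
  refine ⟨n, fun q d => e (step (e.symm q) d), e ⟨_, hbK⟩, fun q => (e.symm q).1 (fun _ => 0), ?_⟩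
  have key (w : List (Fin k)) (q : Fin n) :
      (e.symm (w.foldl (fun q d => e (step (e.symm q) d)) q)).1 (fun _ => 0) =
        (e.symm q).1 (fun _ => Nat.ofDigits k (w.map Fin.val)) := by
    induction w generalizing q with
    | nil => simp
    | cons d w ih =>
      rw [List.foldl_cons, ih, e.symm_apply_apply]
      simp only [step, List.map_cons, Nat.ofDigits_cons]
      rw [add_comm]
  rintro m w rfl
  dsimp only
  rw [key, e.symm_apply_apply]

/-- Strict comparison of the digits at position `m` for the alternating order, with the
parity `p` selecting the order or its reverse. -/
def AltLt (p m : ℕ) (c d : ℤ) : Prop :=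
  if m % 2 = p then c < d else d < c

/-- The factor of length `n + 1` at position `i` occurs infinitely often. -/
def RecurrentFactor (a : ℕ → ℤ) (i n : ℕ) : Prop :=
  ∀ N, ∃ j, N ≤ j ∧ ∀ m, m ≤ n → a (j + m) = a (i + m)

/-- The factor of length `n + 1` at position `j` is smaller than the one at position `i`. -/
def FactorLt (p : ℕ) (a : ℕ → ℤ) (j i n : ℕ) : Prop :=
  ∃ m, m ≤ n ∧ (∀ l, l < m → a (j + l) = a (i + l)) ∧ AltLt p m (a (j + m)) (a (i + m))

/-- The factor of length `n + 1` at position `i` is minimal among the recurrent ones. -/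
def MinimalFactor (p : ℕ) (a : ℕ → ℤ) (i n : ℕ) : Prop :=
  RecurrentFactor a i n ∧ ∀ j, RecurrentFactor a j n → ¬ FactorLt p a j i n

theorem altLt_trichotomy (p m : ℕ) {c d : ℤ} (h : c ≠ d) : AltLt p m c d ∨ AltLt p m d c := by
  unfold AltLt
  split_ifs <;> omega

section

variable {k : ℕ} {a : ℕ → ℤ}

theorem finiteKernel_recurrentFactor (hk : 2 ≤ k) (ha : IsKAutomatic k a) (i n : ℕ) :
    FiniteKernel k (fun v => RecurrentFactor a (v i) (v n)) := by
  have hk' : 0 < k := by omega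
  unfold RecurrentFactor
  refine .forall_first hk' (.exists_first hk' (.map₂ And (.le 1 0) (.forall_first hk' ?_)))
  exact .map₂ (fun P Q : Prop => P → Q) (.le 0 (n + 3))
    (.map₂ Eq (ha.finiteKernel_add hk 1 0) (ha.finiteKernel_add hk (i + 3) 0))

theorem finiteKernel_factorLt (hk : 2 ≤ k) (ha : IsKAutomatic k a) (p j i n : ℕ) :
    FiniteKernel k (fun v => FactorLt p a (v j) (v i) (v n)) := by
  have hk' : 0 < k := by omega
  unfold FactorLt
  refine .exists_first hk' (.map₂ And (.le 0 (n + 1)) (.map₂ And (.forall_first hk' ?_) ?_))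
  · exact .map₂ (fun P Q : Prop => P → Q) (.lt 0 1)
      (.map₂ Eq (ha.finiteKernel_add hk (j + 2) 0) (ha.finiteKernel_add hk (i + 2) 0))
  · exact .map₂ (fun (s : ℕ) (c : ℤ × ℤ) => if s = p then c.1 < c.2 else c.2 < c.1) (.mod_two 0)
      (.map₂ Prod.mk (ha.finiteKernel_add hk (j + 1) 0) (ha.finiteKernel_add hk (i + 1) 0))

theorem finiteKernel_minimalFactor (hk : 2 ≤ k) (ha : IsKAutomatic k a) (p i n : ℕ) :
    FiniteKernel k (fun v => MinimalFactor p a (v i) (v n)) := by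
  have hk' : 0 < k := by omega
  unfold MinimalFactor
  refine .map₂ And (finiteKernel_recurrentFactor hk ha i n) (.forall_first hk' ?_)
  exact .map₂ (fun P Q : Prop => P → ¬ Q) (finiteKernel_recurrentFactor hk ha 0 (n + 1))
    (finiteKernel_factorLt hk ha p 0 (i + 1) (n + 1))

/-- If every prefix of `b` is a factor of `a` that is minimal among the recurrent factors,
then `b` is automatic as soon as `a` is. -/
theorem isKAutomatic_of_minimal (hk : 2 ≤ k) (ha : IsKAutomatic k a) (p : ℕ) {b : ℕ → ℤ}
    (hrec : ∀ n N, ∃ j, N ≤ j ∧ ∀ m, m ≤ n → a (j + m) = b m)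
    (hmin : ∀ i n, RecurrentFactor a i n → ∀ m ≤ n, (∀ l, l < m → a (i + l) = b l) →
      ¬ AltLt p m (a (i + m)) (b m)) :
    IsKAutomatic k b := by
  have hex (n : ℕ) : ∃ i, RecurrentFactor a i n ∧ ∀ m, m ≤ n → a (i + m) = b m := by
    obtain ⟨i, -, hi⟩ := hrec n 0
    refine ⟨i, fun N => ?_, hi⟩
    obtain ⟨j, hj, h⟩ := hrec n N
    exact ⟨j, hj, fun m hm => (h m hm).trans (hi m hm).symm⟩
  have hval (n : ℕ) (c : ℤ) : (∃ i, MinimalFactor p a i n ∧ a (i + n) = c) ↔ c = b n := by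
    obtain ⟨j, hj, hjb⟩ := hex n
    constructor
    · rintro ⟨i, ⟨hi, him⟩, rfl⟩
      have hall : ∀ m, m ≤ n → a (i + m) = b m := by
        intro m
        induction m using Nat.strong_induction_on with
        | _ m ih =>
        intro hm
        have hpre : ∀ l, l < m → a (i + l) = b l := fun l hl => ih l hl (by omega)
        by_contra hne
        rcases altLt_trichotomy p m hne with h | h
        · exact hmin i n hi m hm hpre h
        · refine him j hj ⟨m, hm, fun l hl => ?_, ?_⟩
          · rw [hpre l hl, hjb l (by omega)]
          · rwa [hjb m hm]
      exact hall n le_rfl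
    · rintro rfl
      refine ⟨j, ⟨hj, ?_⟩, hjb n le_rfl⟩
      rintro i hi ⟨m, hm, hpre, hlt⟩
      refine hmin i n hi m hm (fun l hl => ?_) ?_
      · rw [hpre l hl, hjb l (by omega)]
      · rwa [hjb m hm] at hlt
  refine FiniteKernel.isKAutomatic ?_
  have hfin := ((FiniteKernel.map₂ Prod.mk (finiteKernel_minimalFactor hk ha p 0 1)
    (ha.finiteKernel_add hk 0 1)).range_cons (by omega : 0 < k)).map
      (fun S : Set (Prop × ℤ) => Classical.epsilon (fun c => (True, c) ∈ S))
  convert hfin using 2 with v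
  have hS : (fun c : ℤ => (True, c) ∈ Set.range (fun y =>
      (MinimalFactor p a (consAssign y v 0) (consAssign y v 1),
        a (consAssign y v 0 + consAssign y v 1)))) = fun c => c = b (v 0) := by
    funext c
    rw [← hval]
    simp [consAssign]
  rw [hS]
  exact (Classical.epsilon_singleton _).symm

end

/-- All fractional parts along the Gauss orbit of `y` lie in `[e, 1 - e]`. -/
def GaussBounded (e y : ℝ) : Prop :=
  ∀ n, Int.fract (gaussMap^[n] y) ∈ Set.Icc e (1 - e)

theorem gaussMap_eq (y : ℝ) : gaussMap y = (Int.fract y)⁻¹ := by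
  rw [gaussMap, Int.self_sub_floor, one_div]

theorem GaussBounded.iterate {e y : ℝ} (h : GaussBounded e y) (m : ℕ) :
    GaussBounded e (gaussMap^[m] y) := fun n => by
  rw [← Function.iterate_add_apply]
  exact h _

open Filter Topology

theorem tendsto_gaussMap {e : ℝ} (he : 0 < e) {y : ℕ → ℝ} {L : ℝ} (hy : Tendsto y atTop (𝓝 L))
    (hb : ∀ j, Int.fract (y j) ∈ Set.Icc e (1 - e)) :
    Tendsto (fun j => gaussMap (y j)) atTop (𝓝 (gaussMap L)) ∧
      (∀ᶠ j in atTop, ⌊y j⌋ = ⌊L⌋) ∧ Int.fract L ∈ Set.Icc e (1 - e) := by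
  have hfl : ∀ᶠ j in atTop, ⌊y j⌋ = ⌊L⌋ := by
    filter_upwards [Metric.tendsto_nhds.1 hy e he] with j hj
    rw [Real.dist_eq, abs_lt] at hj
    have h1 := (hb j).1
    have h2 := (hb j).2
    have h3 := Int.self_sub_floor (y j)
    exact (Int.floor_eq_iff.2 ⟨by linarith, by linarith⟩).symm
  have hfr : Tendsto (fun j => Int.fract (y j)) atTop (𝓝 (Int.fract L)) := by
    have h : Tendsto (fun j => y j - ⌊L⌋) atTop (𝓝 (L - ⌊L⌋)) := hy.sub_const _
    rw [Int.self_sub_floor] at h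
    refine h.congr' ?_
    filter_upwards [hfl] with j hj
    rw [← hj, Int.self_sub_floor]
  have hmem : Int.fract L ∈ Set.Icc e (1 - e) :=
    isClosed_Icc.mem_of_tendsto hfr (Eventually.of_forall hb)
  refine ⟨?_, hfl, hmem⟩
  simp only [gaussMap_eq]
  exact hfr.inv₀ (by linarith [hmem.1])

theorem tendsto_gaussMap_iterate {e : ℝ} (he : 0 < e) {y : ℕ → ℝ} {L : ℝ}
    (hy : Tendsto y atTop (𝓝 L)) (hb : ∀ j, GaussBounded e (y j)) (n : ℕ) :
    Tendsto (fun j => gaussMap^[n] (y j)) atTop (𝓝 (gaussMap^[n] L)) := by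
  induction n with
  | zero => exact hy
  | succ n ih =>
    simp only [Function.iterate_succ_apply']
    exact (tendsto_gaussMap he ih (fun j => hb j n)).1

theorem GaussBounded.of_tendsto {e : ℝ} (he : 0 < e) {y : ℕ → ℝ} {L : ℝ}
    (hy : Tendsto y atTop (𝓝 L)) (hb : ∀ j, GaussBounded e (y j)) : GaussBounded e L :=
  fun n => (tendsto_gaussMap he (tendsto_gaussMap_iterate he hy hb n) (fun j => hb j n)).2.2

theorem eventually_cfSeq_eq {e : ℝ} (he : 0 < e) {y : ℕ → ℝ} {L : ℝ}
    (hy : Tendsto y atTop (𝓝 L)) (hb : ∀ j, GaussBounded e (y j)) (n : ℕ) :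
    ∀ᶠ j in atTop, ∀ m, m ≤ n → cfSeq (y j) m = cfSeq L m := by
  refine (Set.finite_Iic n).eventually_all.2 fun m _ => ?_
  exact (tendsto_gaussMap he (tendsto_gaussMap_iterate he hy hb m) (fun j => hb j m)).2.1

theorem cfSeq_succ (y : ℝ) (n : ℕ) : cfSeq y (n + 1) = cfSeq (gaussMap y) n := rfl

theorem cfSeq_iterate (x : ℝ) (i m : ℕ) : cfSeq (gaussMap^[i] x) m = cfSeq x (i + m) := by
  rw [cfSeq, cfSeq, ← Function.iterate_add_apply, add_comm]

/-- The order on reals is the alternating lexicographic order on partial quotients. -/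
theorem lt_of_cfSeq {e : ℝ} (he : 0 < e) (m : ℕ) {y z : ℝ} (hy : GaussBounded e y)
    (hz : GaussBounded e z) (hpre : ∀ l, l < m → cfSeq y l = cfSeq z l)
    (hlt : cfSeq y m < cfSeq z m) : if m % 2 = 0 then y < z else z < y := by
  induction m generalizing y z with
  | zero =>
    simp only [Nat.zero_mod, if_true]
    exact lt_of_not_ge fun h => (Int.floor_mono h).not_gt hlt
  | succ m ih =>
    have hfl : ⌊y⌋ = ⌊z⌋ := hpre 0 (by omega)
    have h := ih (hy.iterate 1) (hz.iterate 1) (fun l hl => hpre (l + 1) (by omega)) hlt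
    have hy0 : 0 < Int.fract y := he.trans_le (hy 0).1
    have hz0 : 0 < Int.fract z := he.trans_le (hz 0).1
    have e1 := Int.floor_add_fract y
    have e2 := Int.floor_add_fract z
    rw [hfl] at e1
    simp only [Function.iterate_one, gaussMap_eq, inv_lt_inv₀ hy0 hz0, inv_lt_inv₀ hz0 hy0] at h
    rcases Nat.mod_two_eq_zero_or_one m with hm | hm
    · rw [if_pos hm] at h
      rw [if_neg (by omega)]
      linarith
    · rw [if_neg (by omega)] at h
      rw [if_pos (by omega)]
      linarith

theorem irrational_gaussMap {y : ℝ} (hy : Irrational y) : Irrational (gaussMap y) := by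
  rw [gaussMap_eq]
  exact irrational_inv_iff.2 (hy.sub_intCast _)

theorem irrational_gaussMap_iterate {x : ℝ} (hx : Irrational x) (n : ℕ) :
    Irrational (gaussMap^[n] x) := by
  induction n with
  | zero => exact hx
  | succ n ih =>
    rw [Function.iterate_succ_apply']
    exact irrational_gaussMap ih

theorem exists_gaussBounded {x : ℝ} (hx : Irrational x) {M : ℤ} (hM : ∀ n, cfSeq x n ≤ M) :
    ∃ e > 0, GaussBounded e x := by
  have hpos (n : ℕ) : 0 < Int.fract (gaussMap^[n] x) :=
    Int.fract_pos.2 ((irrational_gaussMap_iterate hx n).ne_int _)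
  have hsucc (n : ℕ) : gaussMap^[n + 1] x = (Int.fract (gaussMap^[n] x))⁻¹ := by
    rw [Function.iterate_succ_apply', gaussMap_eq]
  have hone (n : ℕ) : 1 ≤ cfSeq x (n + 1) := by
    refine Int.le_floor.2 ?_
    rw [hsucc, Int.cast_one]
    exact (one_le_inv₀ (hpos n)).2 (Int.fract_lt_one _).le
  have hMpos : (1 : ℝ) ≤ M := by exact_mod_cast (hone 0).trans (hM 1)
  have hup (n : ℕ) : gaussMap^[n] x < M + 1 := by
    have h1 := Int.lt_floor_add_one (gaussMap^[n] x)
    have h2 : (⌊gaussMap^[n] x⌋ : ℝ) ≤ M := by exact_mod_cast hM n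
    linarith
  have hlow (n : ℕ) : (1 : ℝ) / (M + 1) ≤ Int.fract (gaussMap^[n] x) := by
    have h := hup (n + 1)
    rw [hsucc] at h
    rw [one_div]
    exact (inv_le_comm₀ (by linarith) (hpos n)).2 h.le
  refine ⟨1 / (M + 2), by positivity, fun n => ⟨?_, ?_⟩⟩
  · refine le_trans ?_ (hlow n)
    exact one_div_le_one_div_of_le (by linarith) (by linarith)
  · have h1 : (1 : ℝ) ≤ cfSeq x (n + 1) := by exact_mod_cast hone n
    have h2 := Int.floor_add_fract (gaussMap^[n + 1] x)
    have h3 : 1 + 1 / ((M : ℝ) + 1) ≤ gaussMap^[n + 1] x := by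
      have := hlow (n + 1)
      unfold cfSeq at h1
      linarith
    rw [hsucc] at h3
    have h4 := (le_inv_comm₀ (by positivity) (hpos n)).1 h3
    refine h4.trans (le_of_eq ?_)
    have : (M : ℝ) + 1 ≠ 0 := by linarith
    have : (M : ℝ) + 2 ≠ 0 := by linarith
    field_simp
    ring

/-- The partial quotients of the least (`p = 0`) or greatest (`p = 1`) limit point of the Gauss
orbit of `x` form an automatic sequence if those of `x` do. -/
theorem isKAutomatic_cfSeq_extremal {k : ℕ} (hk : 2 ≤ k) {x e : ℝ} (he : 0 < e)
    (hb : GaussBounded e x) (ha : IsKAutomatic k (cfSeq x))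
    (hbdd : Bornology.IsBounded (Set.range fun n => gaussMap^[n] x)) {p : ℕ} (hp : p < 2) {L : ℝ}
    (hL : MapClusterPt L atTop fun n => gaussMap^[n] x)
    (hext : ∀ L', MapClusterPt L' atTop (fun n => gaussMap^[n] x) →
      if p = 0 then L ≤ L' else L' ≤ L) :
    IsKAutomatic k (cfSeq L) := by
  obtain ⟨φ, hφ, hlim⟩ := hL.tendsto_subseq
  have hbL : GaussBounded e L := .of_tendsto he hlim fun j => hb.iterate (φ j)
  refine isKAutomatic_of_minimal hk ha p ?_ ?_
  · intro n N
    obtain ⟨j, hj, hN⟩ := ((eventually_cfSeq_eq he hlim (fun j => hb.iterate (φ j)) n).and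
      (hφ.tendsto_atTop.eventually_ge_atTop N)).exists
    refine ⟨φ j, hN, fun m hm => ?_⟩
    rw [← cfSeq_iterate]
    exact hj m hm
  · intro i n hi m hm hpre hlt
    choose ψ hψ hψi using hi
    have hψtop : Tendsto ψ atTop atTop := tendsto_atTop_mono hψ tendsto_id
    obtain ⟨L', -, θ, hθ, hlim'⟩ := tendsto_subseq_of_bounded hbdd
      (x := fun j => gaussMap^[ψ j] x) (fun j => ⟨ψ j, rfl⟩)
    have hbj (j : ℕ) : GaussBounded e (((fun j => gaussMap^[ψ j] x) ∘ θ) j) := hb.iterate _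
    have hbL' : GaussBounded e L' := .of_tendsto he hlim' hbj
    have hclus : MapClusterPt L' atTop (fun n => gaussMap^[n] x) :=
      MapClusterPt.of_comp (hψtop.comp hθ.tendsto_atTop) hlim'.mapClusterPt
    have hdig : ∀ l, l ≤ n → cfSeq L' l = cfSeq x (i + l) := by
      obtain ⟨j, hj⟩ := (eventually_cfSeq_eq he hlim' hbj n).exists
      intro l hl
      rw [← hj l hl, ← hψi (θ j) l hl]
      exact cfSeq_iterate _ _ _
    have hord := hext L' hclus
    have hpre' : ∀ l, l < m → cfSeq L' l = cfSeq L l := fun l hl => by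
      rw [hdig l (by omega), hpre l hl]
    rw [← hdig m hm, AltLt] at hlt
    have hcase : (m % 2 = p ∧ cfSeq L' m < cfSeq L m) ∨ (m % 2 ≠ p ∧ cfSeq L m < cfSeq L' m) := by
      split_ifs at hlt with h
      · exact .inl ⟨h, hlt⟩
      · exact .inr ⟨h, hlt⟩
    rcases hcase with ⟨h, hlt⟩ | ⟨h, hlt⟩
    · have key := lt_of_cfSeq he m hbL' hbL hpre' hlt
      rw [h] at key
      split_ifs at key hord <;> linarith
    · have key := lt_of_cfSeq he m hbL hbL' (fun l hl => (hpre' l hl).symm) hlt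
      split_ifs at key hord <;> first | linarith | omega

/-- If `x` is irrational and its continued fraction expansion is `k`-automatic,
then the continued fraction expansions of `liminf Tⁿ x` and `limsup Tⁿ x` are
both `k`-automatic. -/
theorem cf_liminf_limsup_automatic (k : ℕ) (hk : 2 ≤ k) (x : ℝ)
    (hx : Irrational x) (ha : IsKAutomatic k (cfSeq x)) :
    IsKAutomatic k (cfSeq (Filter.liminf (fun n => gaussMap^[n] x) Filter.atTop)) ∧
    IsKAutomatic k (cfSeq (Filter.limsup (fun n => gaussMap^[n] x) Filter.atTop)) := by
  have hfin := ha.finite_range hk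
  obtain ⟨M, hM⟩ := hfin.bddAbove
  obtain ⟨m, hm⟩ := hfin.bddBelow
  obtain ⟨e, he, hb⟩ := exists_gaussBounded hx fun n => hM ⟨n, rfl⟩
  have hIcc (n : ℕ) : gaussMap^[n] x ∈ Set.Icc (m : ℝ) (M + 1) := by
    have h1 : m ≤ ⌊gaussMap^[n] x⌋ := hm ⟨n, rfl⟩
    have h2 : ⌊gaussMap^[n] x⌋ ≤ M := hM ⟨n, rfl⟩
    have h3 : (⌊gaussMap^[n] x⌋ : ℝ) ≤ M := by exact_mod_cast h2
    exact ⟨Int.le_floor.1 h1, by linarith [Int.lt_floor_add_one (gaussMap^[n] x)]⟩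
  have hbdd : Bornology.IsBounded (Set.range fun n => gaussMap^[n] x) :=
    (Metric.isBounded_Icc _ _).subset (Set.range_subset_iff.2 hIcc)
  have hle : Filter.IsBoundedUnder (· ≤ ·) atTop fun n => gaussMap^[n] x :=
    Filter.isBoundedUnder_of ⟨_, fun n => (hIcc n).2⟩
  have hge : Filter.IsBoundedUnder (· ≥ ·) atTop fun n => gaussMap^[n] x :=
    Filter.isBoundedUnder_of ⟨_, fun n => (hIcc n).1⟩
  have hleast := isLeast_mapClusterPt_liminf hle.isCoboundedUnder_ge hge
  have hgreatest := isGreatest_mapClusterPt_limsup hge.isCoboundedUnder_le hle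
  refine ⟨isKAutomatic_cfSeq_extremal hk he hb ha hbdd two_pos hleast.1 fun L' h => ?_,
    isKAutomatic_cfSeq_extremal hk he hb ha hbdd one_lt_two hgreatest.1 fun L' h => ?_⟩
  · simpa using hleast.2 h
  · simpa using hgreatest.2 h
end

section
/- Let k ≥ 2 and let α be an irrational real number whose continued fraction expansion [a_0, a_1, a_2, …] is k-automatic. Let p_n/q_n denote the n-th convergent of the continued fraction of α, and set β = liminf_{n→∞} p_n/p_{n−1}, γ = liminf_{n→∞} q_n/q_{n−1}, δ = limsup_{n→∞} p_n/p_{n−1}, and ζ = limsup_{n→∞} q_n/q_{n−1}. Then the continued fraction expansion of each of β, γ, δ, ζ is k-automatic. -/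
/-- The numerators `pₙ` of the convergents of the continued fraction of `x`:
`p₀ = a₀`, `p₁ = a₁ a₀ + 1`, `pₙ = aₙ p_{n-1} + p_{n-2}`. -/
noncomputable def cfNum (x : ℝ) : ℕ → ℤ
  | 0 => cfSeq x 0
  | 1 => cfSeq x 1 * cfSeq x 0 + 1
  | n + 2 => cfSeq x (n + 2) * cfNum x (n + 1) + cfNum x n

/-- The denominators `qₙ` of the convergents of the continued fraction of `x`:
`q₀ = 1`, `q₁ = a₁`, `qₙ = aₙ q_{n-1} + q_{n-2}`. -/
noncomputable def cfDen (x : ℝ) : ℕ → ℤ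
  | 0 => 1
  | 1 => cfSeq x 1
  | n + 2 => cfSeq x (n + 2) * cfDen x (n + 1) + cfDen x n

open Filter Topology

/-- The `k`-kernel of a sequence. -/
def seqKernel (k : ℕ) {A : Type*} (a : ℕ → A) : Set (ℕ → A) :=
  {s | ∃ e r, r < k ^ e ∧ s = fun n => a (k ^ e * n + r)}

theorem exists_digits_of_lt_pow (k e : ℕ) :
    ∀ r < k ^ e, ∃ w : List (Fin k), w.length = e ∧ Nat.ofDigits k (w.map Fin.val) = r := by
  induction e with
  | zero => intro r hr; exact ⟨[], rfl, by simp at hr; simp [hr]⟩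
  | succ e ih =>
    intro r hr
    have hk : 0 < k := Nat.pos_of_ne_zero (by rintro rfl; simp at hr)
    obtain ⟨w, hw, hwr⟩ := ih (r / k) (Nat.div_lt_of_lt_mul (by rwa [← pow_succ']))
    refine ⟨⟨r % k, Nat.mod_lt _ hk⟩ :: w, by simp [hw], ?_⟩
    simp [Nat.ofDigits_cons, hwr, Nat.mod_add_div]

theorem exists_digits {k : ℕ} (hk : 2 ≤ k) (m : ℕ) :
    ∃ w : List (Fin k), Nat.ofDigits k (w.map Fin.val) = m := by
  obtain ⟨w, -, h⟩ := exists_digits_of_lt_pow k m m (Nat.lt_pow_self hk)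
  exact ⟨w, h⟩

theorem IsKAutomatic.finite_seqKernel {k : ℕ} (hk : 2 ≤ k) {A : Type*} {a : ℕ → A}
    (ha : IsKAutomatic k a) : (seqKernel k a).Finite := by
  obtain ⟨n, δ, q0, τ, h⟩ := ha
  choose w hw using exists_digits hk
  refine (Set.finite_range fun (q : Fin n) (m : ℕ) => τ ((w m).foldl δ q)).subset ?_
  rintro s ⟨e, r, hr, rfl⟩
  obtain ⟨v, hv, hvr⟩ := exists_digits_of_lt_pow k e r hr
  refine ⟨v.foldl δ q0, funext fun m => ?_⟩
  rw [h _ (v ++ w m), List.foldl_append]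
  rw [List.map_append, Nat.ofDigits_append, hvr, hw, List.length_map, hv, add_comm]

theorem isKAutomatic_of_finite_seqKernel {k : ℕ} {A : Type*} {a : ℕ → A}
    (ha : (seqKernel k a).Finite) : IsKAutomatic k a := by
  have : Finite (seqKernel k a) := ha
  obtain ⟨n, ⟨φ⟩⟩ := Finite.exists_equiv_fin (seqKernel k a)
  let step (s : seqKernel k a) (d : Fin k) : seqKernel k a :=
    ⟨fun n => s.1 (k * n + d), by
      obtain ⟨_, e, r, hr, rfl⟩ := s
      refine ⟨e + 1, k ^ e * d + r, ?_, funext fun n => ?_⟩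
      · have := Nat.mul_le_mul_left (k ^ e) (Nat.succ_le_of_lt d.2)
        rw [pow_succ]
        rw [Nat.mul_succ] at this
        omega
      · change a _ = a _
        congr 1
        ring⟩
  have key (w : List (Fin k)) : ∀ s : seqKernel k a,
      (w.foldl step s).1 0 = s.1 (Nat.ofDigits k (w.map Fin.val)) := by
    induction w with
    | nil => intro s; simp
    | cons d w ih =>
      intro s
      rw [List.foldl_cons, ih, List.map_cons, Nat.ofDigits_cons, add_comm]
  have hφ (w : List (Fin k)) : ∀ s : seqKernel k a,
      w.foldl (fun q d => φ (step (φ.symm q) d)) (φ s) = φ (w.foldl step s) := by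
    induction w with
    | nil => intro s; rfl
    | cons d w ih => intro s; simp only [List.foldl_cons, Equiv.symm_apply_apply, ih]
  refine ⟨n, fun q d => φ (step (φ.symm q) d), φ ⟨a, 0, 0, by simp, by simp⟩,
    fun q => (φ.symm q).1 0, ?_⟩
  rintro m w rfl
  simp only [hφ, Equiv.symm_apply_apply, key]

theorem IsKAutomatic.comp {k : ℕ} {A B : Type*} {a : ℕ → A} (ha : IsKAutomatic k a) (f : A → B) :
    IsKAutomatic k fun n => f (a n) := by
  obtain ⟨n, δ, q0, τ, h⟩ := ha
  exact ⟨n, δ, q0, f ∘ τ, fun m w hw => congrArg f (h m w hw)⟩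

theorem IsKAutomatic.exists_finite_alphabet {k : ℕ} (hk : 2 ≤ k) {A : Type*} {a : ℕ → A}
    (ha : IsKAutomatic k a) :
    ∃ (S : Set A) (b : ℕ → S), S.Finite ∧ (∀ n, (b n : A) = a n) ∧ IsKAutomatic k b := by
  obtain ⟨n, δ, q0, τ, h⟩ := ha
  have hmem (m : ℕ) : a m ∈ Set.range τ := by
    obtain ⟨w, hw⟩ := exists_digits hk m
    exact ⟨_, (h m w hw).symm⟩
  exact ⟨Set.range τ, fun m => ⟨a m, hmem m⟩, Set.finite_range τ, fun _ => rfl,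
    n, δ, q0, fun q => ⟨τ q, q, rfl⟩, fun m w hw => Subtype.ext (h m w hw)⟩

section LeftLimit

variable {A : Type*} [Finite A]

theorem exists_eventually_eq (U : Ultrafilter ℕ) (f : ℕ → A) : ∃ v, ∀ᶠ i in U, f i = v := by
  obtain ⟨v, hv⟩ := Ultrafilter.eq_pure_of_finite (U.map f)
  refine ⟨v, ?_⟩
  have : {v} ∈ U.map f := by rw [hv]; exact Ultrafilter.mem_pure.2 rfl
  exact this

/-- The sequence obtained by reading `a` backwards from a position converging along `U`. -/
noncomputable def leftLimit (U : Ultrafilter ℕ) (a : ℕ → A) (n : ℕ) : A :=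
  (exists_eventually_eq U fun i => a (i - n)).choose

theorem eventually_eq_leftLimit (U : Ultrafilter ℕ) (a : ℕ → A) (n : ℕ) :
    ∀ᶠ i in U, a (i - n) = leftLimit U a n :=
  (exists_eventually_eq U fun i => a (i - n)).choose_spec

theorem leftLimit_eq {U : Ultrafilter ℕ} {a : ℕ → A} {n : ℕ} {v : A}
    (h : ∀ᶠ i in U, a (i - n) = v) : leftLimit U a n = v := by
  obtain ⟨i, h1, h2⟩ := (h.and (eventually_eq_leftLimit U a n)).exists
  exact h2.symm.trans h1

theorem leftLimit_eq_block {U : Ultrafilter ℕ} (hU : (U : Filter ℕ) ≤ atTop) (a : ℕ → A)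
    {m c : ℕ} (hc : ∀ᶠ i in U, i % m + c + 1 = m) (n : ℕ) :
    leftLimit U a n = leftLimit (U.map (· / m))
      (fun i => a (m * i + (m - 1 - (n + c) % m))) ((n + c) / m) := by
  apply leftLimit_eq
  have h := eventually_eq_leftLimit (U.map (· / m))
    (fun i => a (m * i + (m - 1 - (n + c) % m))) ((n + c) / m)
  rw [Ultrafilter.coe_map, eventually_map] at h
  filter_upwards [h, hc, hU (eventually_ge_atTop (n + c))] with i h1 h2 h3
  rw [← h1]
  congr 1
  obtain ⟨d, hd⟩ := Nat.exists_eq_add_of_le (Nat.div_le_div_right (c := m) h3)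
  have h4 := Nat.div_add_mod i m
  have h5 := Nat.div_add_mod (n + c) m
  have h6 := Nat.mod_lt (n + c) (show 0 < m by omega)
  rw [hd] at h4 ⊢
  rw [mul_add] at h4
  rw [Nat.add_sub_cancel_left]
  omega

theorem Ultrafilter.map_le_atTop {U : Ultrafilter ℕ} (hU : (U : Filter ℕ) ≤ atTop) {f : ℕ → ℕ}
    (hf : Tendsto f atTop atTop) : (U.map f : Filter ℕ) ≤ atTop :=
  (Filter.map_mono hU).trans hf

end LeftLimit

section SeqLT

variable {A G : Type*}

/-- Strict lexicographic comparison of sequences, with letters at position `n` compared by `R n`. -/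
def SeqLT (R : ℕ → A → A → Prop) (y y' : ℕ → A) : Prop :=
  ∃ n, (∀ m < n, y m = y' m) ∧ R n (y n) (y' n)

/-- Replace each letter `g` of `x` by the block `u 0 g, …, u (m - 1) g`, and drop the first `c`
letters. -/
def blockSeq (m c : ℕ) (u : ℕ → G → A) (x : ℕ → G) (n : ℕ) : A :=
  u ((n + c) % m) (x ((n + c) / m))

/-- Comparison of the `j`-th blocks of two sequences `blockSeq m c u x`. -/
def BlockLT (R : ℕ → A → A → Prop) (m c : ℕ) (u : ℕ → G → A) (j : ℕ) (g g' : G) : Prop :=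
  ∃ i < m, c ≤ m * j + i ∧ (∀ i' < i, c ≤ m * j + i' → u i' g = u i' g') ∧
    R (m * j + i - c) (u i g) (u i g')

theorem seqLT_trichotomy {R : ℕ → A → A → Prop} (hR : ∀ n u v, u ≠ v → R n u v ∨ R n v u)
    {y y' : ℕ → A} (h : ¬ SeqLT R y y') (h' : ¬ SeqLT R y' y) : y = y' := by
  classical
  by_contra hne
  have hex : ∃ n, y n ≠ y' n := Function.ne_iff.1 hne
  have hlt : ∀ m < Nat.find hex, y m = y' m := fun m hm => not_not.1 (Nat.find_min hex hm)
  rcases hR (Nat.find hex) _ _ (Nat.find_spec hex) with h1 | h1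
  · exact h ⟨_, hlt, h1⟩
  · exact h' ⟨_, fun m hm => (hlt m hm).symm, h1⟩

theorem seqLT_blockSeq_iff {R : ℕ → A → A → Prop} (hR : ∀ n u v, u ≠ v → R n u v ∨ R n v u)
    (hirr : ∀ n u, ¬ R n u u) {m c : ℕ} (hc : c < m) (u : ℕ → G → A) (x x' : ℕ → G) :
    SeqLT R (blockSeq m c u x) (blockSeq m c u x') ↔
      ∃ j, (∀ j' < j, ¬ BlockLT R m c u j' (x j') (x' j') ∧ ¬ BlockLT R m c u j' (x' j') (x j')) ∧
        BlockLT R m c u j (x j) (x' j) := by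
  have hval (z : ℕ → G) {j i : ℕ} (hi : i < m) (hci : c ≤ m * j + i) :
      blockSeq m c u z (m * j + i - c) = u i (z j) := by
    rw [blockSeq, Nat.sub_add_cancel hci, Nat.mul_add_mod, Nat.mod_eq_of_lt hi,
      Nat.mul_add_div (by omega), Nat.div_eq_of_lt hi, add_zero]
  constructor
  · rintro ⟨n, hn, hlt⟩
    have hdm := Nat.div_add_mod (n + c) m
    have hmod : (n + c) % m < m := Nat.mod_lt _ (by omega)
    have hagree {j i : ℕ} (hi : i < m) (hci : c ≤ m * j + i) (hlt : m * j + i < n + c) :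
        u i (x j) = u i (x' j) := by
      have := hn (m * j + i - c) (by omega)
      rwa [hval x hi hci, hval x' hi hci] at this
    refine ⟨(n + c) / m, fun j hj => ?_, (n + c) % m, hmod, by omega, fun i hi hci => ?_, ?_⟩
    · have hj' := Nat.mul_le_mul_left m (Nat.succ_le_of_lt hj)
      rw [Nat.mul_succ] at hj'
      constructor <;>
      · rintro ⟨i, hi, hci, -, hRi⟩
        rw [hagree hi hci (by omega)] at hRi
        exact hirr _ _ hRi
    · exact hagree (by omega) hci (by omega)
    · rw [hdm, Nat.add_sub_cancel]
      exact hlt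
  · rintro ⟨j, hj, i, hi, hci, hagree, hRi⟩
    refine ⟨m * j + i - c, fun n hn => ?_, by rwa [hval x hi hci, hval x' hi hci]⟩
    have hdm := Nat.div_add_mod (n + c) m
    have hmod : (n + c) % m < m := Nat.mod_lt _ (by omega)
    change u _ _ = u _ _
    have hjle : (n + c) / m ≤ j := by
      by_contra! hcon
      have := Nat.mul_le_mul_left m (Nat.succ_le_of_lt hcon)
      rw [Nat.mul_succ] at this
      omega
    rcases hjle.lt_or_eq with hlt | heq
    · classical
      by_contra hne
      generalize (n + c) / m = q at *
      have hex : ∃ t, t < m ∧ c ≤ m * q + t ∧ u t (x q) ≠ u t (x' q) :=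
        ⟨(n + c) % m, hmod, by omega, hne⟩
      obtain ⟨h1, h2, h3⟩ := Nat.find_spec hex
      have hmin : ∀ t < Nat.find hex, c ≤ m * q + t → u t (x q) = u t (x' q) :=
        fun t ht hct => by
          by_contra hcon
          exact Nat.find_min hex ht ⟨by omega, hct, hcon⟩
      rcases hR (m * q + Nat.find hex - c) _ _ h3 with h | h
      · exact (hj _ hlt).1 ⟨_, h1, h2, hmin, h⟩
      · exact (hj _ hlt).2 ⟨_, h1, h2, fun t ht hct => (hmin t ht hct).symm, h⟩
    · rw [heq] at hdm ⊢
      exact hagree _ (by omega) (by omega)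

theorem blockLT_add_two {R : ℕ → A → A → Prop} (hper : ∀ n, R (n + 2) = R n) {m c : ℕ}
    (hc : c < m) (u : ℕ → G → A) (j : ℕ) :
    BlockLT R m c u (j + 3) = BlockLT R m c u (j + 1) := by
  have hper' (n t : ℕ) : R (n + 2 * t) = R n := by
    induction t with
    | zero => rfl
    | succ t ih => rw [Nat.mul_succ, ← add_assoc, hper, ih]
  have hle : c ≤ m * (j + 1) := by rw [Nat.mul_succ]; omega
  have hsub (i : ℕ) : m * (j + 3) + i - c = m * (j + 1) + i - c + 2 * m := by
    have : m * (j + 3) = m * (j + 1) + 2 * m := by ring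
    omega
  have hle' (i : ℕ) : c ≤ m * (j + 1) + i := by omega
  have hle'' (i : ℕ) : c ≤ m * (j + 3) + i := by
    have : m * (j + 3) = m * (j + 1) + 2 * m := by ring
    omega
  ext g g'
  simp only [BlockLT, hsub, hper', hle', hle'', true_and, true_imp_iff]

theorem blockLT_congr {R : ℕ → A → A → Prop} (hper : ∀ n, R (n + 2) = R n) {m c m' c' : ℕ}
    (hc : c < m) (hc' : c' < m') {u u' : ℕ → G → A}
    (h : ∀ j : Fin 3, BlockLT R m c u j = BlockLT R m' c' u' j) :
    ∀ j, BlockLT R m c u j = BlockLT R m' c' u' j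
  | 0 => h 0
  | 1 => h 1
  | 2 => h 2
  | j + 3 => by
    rw [blockLT_add_two hper hc, blockLT_add_two hper hc', blockLT_congr hper hc hc' h]

end SeqLT

section Minimal

variable {A : Type*} [Finite A] {k : ℕ} {a : ℕ → A}

/-- The letters of the block of length `k ^ e` read backwards, as elements of the kernel. -/
def revBlock (hk : 0 < k) (a : ℕ → A) (e i : ℕ) (g : seqKernel k a → A) : A :=
  g ⟨fun n => a (k ^ e * n + (k ^ e - 1 - i)), e, _, by have := Nat.pow_pos (n := e) hk; omega, rfl⟩

/-- The left limits along `U` of all the kernel sequences at once. -/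
noncomputable def kernelLimit (k : ℕ) (a : ℕ → A) (U : Ultrafilter ℕ) (n : ℕ)
    (s : seqKernel k a) : A :=
  leftLimit U s.1 n

theorem leftLimit_eq_blockSeq (hk : 0 < k) {U : Ultrafilter ℕ} (hU : (U : Filter ℕ) ≤ atTop)
    {e c : ℕ} (hc : ∀ᶠ i in U, i % k ^ e + c + 1 = k ^ e) :
    leftLimit U a =
      blockSeq (k ^ e) c (revBlock hk a e) (kernelLimit k a (U.map (· / k ^ e))) :=
  funext fun n => leftLimit_eq_block hU a hc n

theorem exists_leftLimit_eq_blockSeq (hk : 0 < k) {U : Ultrafilter ℕ}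
    (hU : (U : Filter ℕ) ≤ atTop) (e : ℕ) :
    ∃ c < k ^ e, ∃ V : Ultrafilter ℕ, (V : Filter ℕ) ≤ atTop ∧
      leftLimit U a = blockSeq (k ^ e) c (revBlock hk a e) (kernelLimit k a V) := by
  have hpos : 0 < k ^ e := Nat.pow_pos hk
  obtain ⟨v, hv⟩ := exists_eventually_eq U fun i => (⟨i % k ^ e, Nat.mod_lt _ hpos⟩ : Fin (k ^ e))
  have hv' : ∀ᶠ i in U, i % k ^ e + (k ^ e - 1 - v) + 1 = k ^ e := by
    filter_upwards [hv] with i hi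
    have h1 : i % k ^ e = v := congrArg Fin.val hi
    have := v.2
    omega
  exact ⟨k ^ e - 1 - v, by omega, U.map (· / k ^ e),
    Ultrafilter.map_le_atTop hU (Nat.tendsto_div_const_atTop hpos.ne'),
    leftLimit_eq_blockSeq hk hU hv'⟩

theorem exists_blockSeq_eq_leftLimit (hk : 0 < k) {V : Ultrafilter ℕ}
    (hV : (V : Filter ℕ) ≤ atTop) {e c : ℕ} (hc : c < k ^ e) :
    ∃ U : Ultrafilter ℕ, (U : Filter ℕ) ≤ atTop ∧
      blockSeq (k ^ e) c (revBlock hk a e) (kernelLimit k a V) = leftLimit U a := by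
  have hlt : k ^ e - 1 - c < k ^ e := by omega
  have hU : (V.map (fun i => k ^ e * i + (k ^ e - 1 - c)) : Filter ℕ) ≤ atTop :=
    Ultrafilter.map_le_atTop hV (tendsto_atTop_mono
      (fun i => (Nat.le_mul_of_pos_left i (by omega)).trans (Nat.le_add_right _ _)) tendsto_id)
  refine ⟨_, hU, ?_⟩
  rw [leftLimit_eq_blockSeq hk hU (e := e) (c := c)]
  · congr 2
    rw [Ultrafilter.map_map]
    convert (Ultrafilter.map_id V).symm
    funext i
    simp [Nat.mul_add_div (show 0 < k ^ e by omega), Nat.div_eq_of_lt hlt]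
  · rw [Ultrafilter.coe_map, eventually_map]
    refine Eventually.of_forall fun i => ?_
    rw [Nat.mul_add_mod, Nat.mod_eq_of_lt hlt]
    omega

/-- A left limit of an automatic sequence that is minimal for a (2-periodically twisted)
lexicographic order is automatic. -/
theorem isKAutomatic_leftLimit_of_minimal (hk : 2 ≤ k) (ha : IsKAutomatic k a)
    {R : ℕ → A → A → Prop} (hR : ∀ n u v, u ≠ v → R n u v ∨ R n v u)
    (hirr : ∀ n u, ¬ R n u u) (hper : ∀ n, R (n + 2) = R n)
    {U : Ultrafilter ℕ} (hU : (U : Filter ℕ) ≤ atTop)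
    (hmin : ∀ V : Ultrafilter ℕ, (V : Filter ℕ) ≤ atTop →
      ¬ SeqLT R (leftLimit V a) (leftLimit U a)) :
    IsKAutomatic k (leftLimit U a) := by
  have hk0 : 0 < k := by omega
  have : Finite (seqKernel k a) := ha.finite_seqKernel hk
  choose c hc V hV hUV using exists_leftLimit_eq_blockSeq (a := a) hk0 hU
  let data (e : ℕ) (j : Fin 3) := BlockLT R (k ^ e) (c e) (revBlock hk0 a e) j
  have hrep (e : ℕ) : ∃ e', data e' = data e ∧
      e' = Function.invFun (Set.rangeFactorization data) ⟨data e, e, rfl⟩ := by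
    refine ⟨_, ?_, rfl⟩
    exact congrArg Subtype.val
      (Function.invFun_eq (f := Set.rangeFactorization data) ⟨e, rfl⟩)
  -- All minimizers for the order pulled back to blocks have the same image.
  have himage {e e' : ℕ} (h : data e' = data e) :
      leftLimit U a = blockSeq (k ^ e) (c e) (revBlock hk0 a e) (kernelLimit k a (V e')) := by
    have hB := blockLT_congr hper (hc e') (hc e) (congrFun h)
    apply seqLT_trichotomy hR
    · rw [hUV e, seqLT_blockSeq_iff hR hirr (hc e)]
      simp only [← hB]
      rw [← seqLT_blockSeq_iff hR hirr (hc e'), ← hUV e']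
      obtain ⟨W, hW, hWeq⟩ := exists_blockSeq_eq_leftLimit (a := a) hk0 (hV e) (hc e')
      rw [hWeq]
      exact hmin W hW
    · obtain ⟨W, hW, hWeq⟩ := exists_blockSeq_eq_leftLimit (a := a) hk0 (hV e') (hc e)
      rw [hWeq]
      exact hmin W hW
  apply isKAutomatic_of_finite_seqKernel
  refine (Set.finite_range fun (t : Set.range data × Fin 2 × seqKernel k a) (n : ℕ) =>
    kernelLimit k a (V (Function.invFun (Set.rangeFactorization data) t.1)) (n + t.2.1)
      t.2.2).subset ?_
  rintro _ ⟨e, r, hr, rfl⟩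
  obtain ⟨e', he', heq⟩ := hrep e
  have hpos : 0 < k ^ e := by omega
  have hce := hc e
  have hdiv : (r + c e) / k ^ e < 2 := Nat.div_lt_of_lt_mul (by omega)
  refine ⟨⟨⟨data e, e, rfl⟩, ⟨_, hdiv⟩, ⟨_, e, k ^ e - 1 - (r + c e) % k ^ e,
    Nat.sub_one_sub_lt_of_lt (Nat.mod_lt _ hpos), rfl⟩⟩,
    funext fun n => ?_⟩
  rw [himage he']
  simp only [blockSeq, revBlock, ← heq]
  rw [add_assoc, Nat.mul_add_mod, Nat.mul_add_div hpos]

end Minimal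

section Extremal

variable {r : ℕ → ℝ}

theorem mapClusterPt_liminf {f : Filter ℕ} [f.NeBot] (h₁ : f.IsBoundedUnder (· ≤ ·) r)
    (h₂ : f.IsBoundedUnder (· ≥ ·) r) : MapClusterPt (liminf r f) f r := by
  rw [(nhds_basis_Ioo _).mapClusterPt_iff_frequently]
  rintro ⟨b, c⟩ ⟨hb, hc⟩
  have hfreq := frequently_lt_of_liminf_lt h₁.isCoboundedUnder_ge hc
  exact (hfreq.and_eventually (eventually_lt_of_lt_liminf hb h₂)).mono fun i hi => ⟨hi.2, hi.1⟩

theorem mapClusterPt_limsup {f : Filter ℕ} [f.NeBot] (h₁ : f.IsBoundedUnder (· ≤ ·) r)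
    (h₂ : f.IsBoundedUnder (· ≥ ·) r) : MapClusterPt (limsup r f) f r := by
  rw [(nhds_basis_Ioo _).mapClusterPt_iff_frequently]
  rintro ⟨b, c⟩ ⟨hb, hc⟩
  have hfreq := frequently_lt_of_lt_limsup h₂.isCoboundedUnder_le hb
  exact (hfreq.and_eventually (eventually_lt_of_limsup_lt hc h₁)).mono fun i hi => ⟨hi.1, hi.2⟩

theorem liminf_le_of_tendsto {f g : Filter ℕ} [g.NeBot] (hg : g ≤ f)
    (h₂ : f.IsBoundedUnder (· ≥ ·) r) {x : ℝ} (hx : Tendsto r g (𝓝 x)) : liminf r f ≤ x :=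
  le_of_forall_lt_imp_le_of_dense fun _ hb =>
    ge_of_tendsto hx ((eventually_lt_of_lt_liminf hb h₂ |>.filter_mono hg).mono fun _ h => h.le)

theorem le_limsup_of_tendsto {f g : Filter ℕ} [g.NeBot] (hg : g ≤ f)
    (h₁ : f.IsBoundedUnder (· ≤ ·) r) {x : ℝ} (hx : Tendsto r g (𝓝 x)) : x ≤ limsup r f :=
  le_of_forall_gt_imp_ge_of_dense fun _ hb =>
    le_of_tendsto hx ((eventually_lt_of_limsup_lt hb h₁ |>.filter_mono hg).mono fun _ h => h.le)

end Extremal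

section ContinuedFraction

/-- `IsCFTails y t` says that `t n > 1` are the complete quotients of the continued fraction
with partial quotients `y`. -/
def IsCFTails (y : ℕ → ℤ) (t : ℕ → ℝ) : Prop :=
  ∀ n, 1 < t n ∧ t n = y n + 1 / t (n + 1)

variable {y y' : ℕ → ℤ} {t t' : ℕ → ℝ}

theorem IsCFTails.floor_eq (h : IsCFTails y t) (n : ℕ) : ⌊t n⌋ = y n := by
  have h1 := (h (n + 1)).1
  rw [Int.floor_eq_iff, (h n).2]
  have h2 : 0 < 1 / t (n + 1) := by positivity
  have h3 : 1 / t (n + 1) < 1 := by rw [div_lt_one (by linarith)]; exact h1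
  constructor <;> linarith

theorem IsCFTails.cfSeq_eq (h : IsCFTails y t) : cfSeq (t 0) = y := by
  have hit (n : ℕ) : gaussMap^[n] (t 0) = t n := by
    induction n with
    | zero => rfl
    | succ n ih =>
      rw [Function.iterate_succ_apply', ih, gaussMap, h.floor_eq, (h n).2, add_sub_cancel_left,
        one_div_one_div]
  funext n
  rw [cfSeq, hit, h.floor_eq]

/-- The order on letters at position `n` for the alternating lexicographic order. -/
def altLT {α : Type*} [LT α] (n : ℕ) (u v : α) : Prop :=
  if Even n then u < v else v < u

theorem altLT_trichotomy {α : Type*} [LinearOrder α] (n : ℕ) (u v : α) (h : u ≠ v) :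
    altLT n u v ∨ altLT n v u := by
  unfold altLT
  split_ifs
  · exact h.lt_or_gt
  · exact h.symm.lt_or_gt

theorem altLT_irrefl {α : Type*} [Preorder α] (n : ℕ) (u : α) : ¬ altLT n u u := by
  simp [altLT]

theorem altLT_add_two {α : Type*} [LT α] (n : ℕ) : altLT (α := α) (n + 2) = altLT n := by
  funext u v
  simp [altLT, Nat.even_add]

theorem altLT_succ {α : Type*} [LT α] (n : ℕ) (u v : α) : altLT (n + 1) u v ↔ altLT n v u := by
  simp only [altLT, Nat.even_add_one]
  split_ifs <;> simp_all

theorem IsCFTails.lt_of_altLT {n : ℕ} (h : IsCFTails y t) (h' : IsCFTails y' t')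
    (heq : ∀ m < n, y m = y' m) (hlt : altLT n (y n) (y' n)) : t 0 < t' 0 := by
  induction n generalizing y y' t t' with
  | zero =>
    simp only [altLT, Even.zero, if_true] at hlt
    rw [← h.floor_eq, ← h'.floor_eq] at hlt
    exact Int.floor_mono.reflect_lt hlt
  | succ n ih =>
    have h1 : t' 1 < t 1 := ih (y := fun n => y' (n + 1)) (y' := fun n => y (n + 1))
      (t := fun n => t' (n + 1)) (t' := fun n => t (n + 1))
      (fun m => h' (m + 1)) (fun m => h (m + 1))
      (fun m hm => (heq (m + 1) (by omega)).symm) ((altLT_succ _ _ _).1 hlt)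
    have h2 := (h' 1).1
    rw [(h 0).2, (h' 0).2, heq 0 (by omega)]
    have := one_div_lt_one_div_of_lt (by linarith) h1
    simpa using this

theorem IsCFTails.lt_of_seqLT {S : Set ℤ} {s s' : ℕ → S} (h : IsCFTails (fun n => s n) t)
    (h' : IsCFTails (fun n => s' n) t') (hlt : SeqLT altLT s s') : t 0 < t' 0 := by
  obtain ⟨n, heq, hn⟩ := hlt
  exact h.lt_of_altLT h' (fun m hm => congrArg Subtype.val (heq m hm)) hn

variable {S : Set ℤ} {a : ℕ → S} {r : ℕ → ℝ}

theorem exists_isCFTails_leftLimit [Finite S] {C : ℝ} (hr1 : ∀ᶠ i in atTop, 1 ≤ r i)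
    (hrC : ∀ᶠ i in atTop, r i ≤ C) (ha1 : ∀ᶠ i in atTop, 1 ≤ (a i : ℤ))
    (hrec : ∀ᶠ i in atTop, r (i + 1) = (a (i + 1) : ℤ) + 1 / r i)
    {U : Ultrafilter ℕ} (hU : (U : Filter ℕ) ≤ atTop) :
    ∃ t, Tendsto r U (𝓝 (t 0)) ∧ IsCFTails (fun n => (leftLimit U a n).1) t := by
  have hshift (n : ℕ) : Tendsto (fun i => i - n) (U : Filter ℕ) atTop :=
    (tendsto_sub_atTop_nat n).mono_left hU
  have hlim (n : ℕ) : ∃ x ∈ Set.Icc 1 C, Tendsto (fun i => r (i - n)) U (𝓝 x) := by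
    refine isCompact_Icc.ultrafilter_le_nhds (U.map fun i => r (i - n)) ?_
    rw [le_principal_iff, Ultrafilter.coe_map, mem_map]
    filter_upwards [(hshift n).eventually hr1, (hshift n).eventually hrC] with i h1 h2
      using ⟨h1, h2⟩
  choose t ht htr using hlim
  have hstep (n : ℕ) : t n = (leftLimit U a n).1 + 1 / t (n + 1) := by
    refine tendsto_nhds_unique (htr n) (Tendsto.congr' ?_
      (tendsto_const_nhds.add (tendsto_const_nhds.div (htr (n + 1)) (by linarith [(ht (n + 1)).1]))))
    filter_upwards [(hshift (n + 1)).eventually hrec, eventually_eq_leftLimit U a n,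
      hU (eventually_ge_atTop (n + 1))] with i h1 h2 h3
    rw [show i - (n + 1) + 1 = i - n by omega, h2] at h1
    exact h1.symm
  refine ⟨t, by simpa using htr 0, fun n => ⟨?_, hstep n⟩⟩
  obtain ⟨i, h1, h2⟩ := (((hshift n).eventually ha1).and (eventually_eq_leftLimit U a n)).exists
  rw [h2] at h1
  have h3 : (1 : ℝ) ≤ (leftLimit U a n).1 := by exact_mod_cast h1
  have h4 : 0 < 1 / t (n + 1) := one_div_pos.2 (by linarith [(ht (n + 1)).1])
  linarith [hstep n]

theorem isKAutomatic_cfSeq_liminf_limsup {k : ℕ} (hk : 2 ≤ k) {a : ℕ → ℤ} (ha : IsKAutomatic k a)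
    (hr1 : ∀ᶠ i in atTop, 1 ≤ r i) (ha1 : ∀ᶠ i in atTop, 1 ≤ a i)
    (hrec : ∀ᶠ i in atTop, r (i + 1) = a (i + 1) + 1 / r i) :
    IsKAutomatic k (cfSeq (liminf r atTop)) ∧ IsKAutomatic k (cfSeq (limsup r atTop)) := by
  obtain ⟨S, b, hS, hb, hbk⟩ := ha.exists_finite_alphabet hk
  obtain ⟨C, hC⟩ := hS.bddAbove
  have : Finite S := hS
  have hrC : ∀ᶠ i in atTop, r i ≤ C + 1 := by
    rw [← map_add_atTop_eq_nat 1, eventually_map]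
    filter_upwards [hr1, hrec] with i h1 h2
    have h3 : (a (i + 1) : ℝ) ≤ C := by exact_mod_cast hb (i + 1) ▸ hC (b (i + 1)).2
    have h4 : 1 / r i ≤ 1 := (div_le_one (by linarith)).2 h1
    linarith
  have hbdd₁ : atTop.IsBoundedUnder (· ≤ ·) r := ⟨_, hrC⟩
  have hbdd₂ : atTop.IsBoundedUnder (· ≥ ·) r := ⟨1, hr1⟩
  have htails {U : Ultrafilter ℕ} (hU : (U : Filter ℕ) ≤ atTop) :=
    exists_isCFTails_leftLimit (a := b) hr1 hrC (by simpa only [hb] using ha1)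
      (by simpa only [hb] using hrec) hU
  constructor
  · obtain ⟨U, hU, hUr⟩ := mapClusterPt_iff_ultrafilter.1 (mapClusterPt_liminf hbdd₁ hbdd₂)
    obtain ⟨t, htr, ht⟩ := htails hU
    rw [tendsto_nhds_unique hUr htr, ht.cfSeq_eq]
    refine (isKAutomatic_leftLimit_of_minimal hk hbk altLT_trichotomy altLT_irrefl altLT_add_two hU
      fun V hV hlt => ?_).comp Subtype.val
    obtain ⟨t', htr', ht'⟩ := htails hV
    have h1 := ht'.lt_of_seqLT ht hlt
    have h2 := liminf_le_of_tendsto hV hbdd₂ htr'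
    rw [tendsto_nhds_unique hUr htr] at h2
    exact h1.not_ge h2
  · obtain ⟨U, hU, hUr⟩ := mapClusterPt_iff_ultrafilter.1 (mapClusterPt_limsup hbdd₁ hbdd₂)
    obtain ⟨t, htr, ht⟩ := htails hU
    rw [tendsto_nhds_unique hUr htr, ht.cfSeq_eq]
    refine (isKAutomatic_leftLimit_of_minimal hk hbk (R := fun n => altLT (n + 1))
      (fun n => altLT_trichotomy (n + 1)) (fun n => altLT_irrefl (n + 1))
      (fun n => altLT_add_two (n + 1)) hU fun V hV hlt => ?_).comp Subtype.val
    obtain ⟨t', htr', ht'⟩ := htails hV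
    obtain ⟨n, heq, hn⟩ := hlt
    have h1 := ht.lt_of_seqLT ht' ⟨n, fun m hm => (heq m hm).symm, (altLT_succ _ _ _).1 hn⟩
    have h2 := le_limsup_of_tendsto hV hbdd₁ htr'
    rw [tendsto_nhds_unique hUr htr] at h2
    exact h1.not_ge h2

theorem isKAutomatic_cfSeq_ratio {k : ℕ} (hk : 2 ≤ k) {a : ℕ → ℤ} (ha : IsKAutomatic k a)
    (ha1 : ∀ n, 1 ≤ a (n + 1)) {P : ℕ → ℤ} (hP : ∀ n, P (n + 2) = a (n + 2) * P (n + 1) + P n)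
    (h0 : 0 ≤ P 0) (h1 : 0 ≤ P 1) (h01 : 0 < P 0 + P 1) :
    IsKAutomatic k (cfSeq (liminf (fun n => (P (n + 1) : ℝ) / (P n : ℝ)) atTop)) ∧
    IsKAutomatic k (cfSeq (limsup (fun n => (P (n + 1) : ℝ) / (P n : ℝ)) atTop)) := by
  have hstep (n : ℕ) (hn : 0 ≤ P n) (hn' : 0 ≤ P (n + 1)) : P (n + 1) + P n ≤ P (n + 2) := by
    rw [hP]
    nlinarith [ha1 (n + 1)]
  have hnn (n : ℕ) : 0 ≤ P n ∧ 0 ≤ P (n + 1) ∧ 0 < P n + P (n + 1) := by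
    induction n with
    | zero => exact ⟨h0, h1, h01⟩
    | succ n ih =>
      have := hstep n ih.1 ih.2.1
      exact ⟨ih.2.1, by rw [add_assoc]; linarith, by rw [add_assoc]; linarith⟩
  have hpos (n : ℕ) : 0 < P (n + 2) := by
    have := hstep n (hnn n).1 (hnn n).2.1
    linarith [(hnn n).2.2]
  have hmono (n : ℕ) : P (n + 2) ≤ P (n + 3) := by
    have := hstep (n + 1) (hnn (n + 1)).1 (hnn (n + 1)).2.1
    rw [add_assoc, add_assoc] at this
    linarith [(hnn (n + 1)).1]
  let r (n : ℕ) : ℝ := P n / P (n - 1)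
  have hkey := isKAutomatic_cfSeq_liminf_limsup (r := r) hk ha ?_ ?_ ?_
  · rwa [← liminf_nat_add r 1, ← limsup_nat_add r 1] at hkey
  · filter_upwards [eventually_ge_atTop 3] with i hi
    obtain ⟨n, rfl⟩ := Nat.exists_eq_add_of_le' hi
    change (1 : ℝ) ≤ P (n + 3) / P (n + 2)
    rw [one_le_div (by exact_mod_cast hpos n)]
    exact_mod_cast hmono n
  · filter_upwards [eventually_ge_atTop 1] with i hi
    obtain ⟨n, rfl⟩ := Nat.exists_eq_add_of_le' hi
    exact ha1 n
  · filter_upwards [eventually_ge_atTop 3] with i hi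
    obtain ⟨n, rfl⟩ := Nat.exists_eq_add_of_le' hi
    change (P (n + 4) / P (n + 3) : ℝ) = a (n + 4) + 1 / (P (n + 3) / P (n + 2))
    have hne : (P (n + 3) : ℝ) ≠ 0 := by exact_mod_cast (hpos (n + 1)).ne'
    rw [hP (n + 2)]
    push_cast
    field_simp

theorem one_le_cfSeq_succ {x : ℝ} (hx : Irrational x) (n : ℕ) : 1 ≤ cfSeq x (n + 1) := by
  have hgauss {z : ℝ} (hz : Irrational z) : Irrational (gaussMap z) := by
    rw [gaussMap, one_div]
    exact (hz.sub_intCast _).inv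
  have hirr : Irrational (gaussMap^[n] x) := by
    induction n with
    | zero => exact hx
    | succ n ih => rw [Function.iterate_succ_apply']; exact hgauss ih
  rw [cfSeq, Function.iterate_succ_apply', Int.le_floor, gaussMap, Int.cast_one]
  have h1 : 0 < Int.fract (gaussMap^[n] x) :=
    (Int.fract_nonneg _).lt_of_ne' ((hirr.sub_intCast _).ne_zero)
  exact (one_le_div h1).2 (Int.fract_lt_one _).le

end ContinuedFraction

/-- Let `α` be irrational with `k`-automatic continued fraction expansion, and
let `pₙ/qₙ` be its convergents. Then the continued fraction expansions of
`β = liminf pₙ/p_{n-1}`, `γ = liminf qₙ/q_{n-1}`, `δ = limsup pₙ/p_{n-1}` and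
`ζ = limsup qₙ/q_{n-1}` are all `k`-automatic. -/
theorem cf_convergentRatios_automatic (k : ℕ) (hk : 2 ≤ k) (α : ℝ)
    (hα : Irrational α) (ha : IsKAutomatic k (cfSeq α)) :
    IsKAutomatic k (cfSeq (Filter.liminf
      (fun n => (cfNum α (n + 1) : ℝ) / (cfNum α n : ℝ)) Filter.atTop)) ∧
    IsKAutomatic k (cfSeq (Filter.liminf
      (fun n => (cfDen α (n + 1) : ℝ) / (cfDen α n : ℝ)) Filter.atTop)) ∧
    IsKAutomatic k (cfSeq (Filter.limsup
      (fun n => (cfNum α (n + 1) : ℝ) / (cfNum α n : ℝ)) Filter.atTop)) ∧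
    IsKAutomatic k (cfSeq (Filter.limsup
      (fun n => (cfDen α (n + 1) : ℝ) / (cfDen α n : ℝ)) Filter.atTop)) := by
  have ha1 := one_le_cfSeq_succ hα
  have hden := isKAutomatic_cfSeq_ratio hk ha ha1 (P := cfDen α) (fun _ => rfl)
    zero_le_one (zero_le_one.trans (ha1 0)) (add_pos_of_pos_of_nonneg one_pos
      (zero_le_one.trans (ha1 0)))
  have hnum : IsKAutomatic k (cfSeq (Filter.liminf
      (fun n => (cfNum α (n + 1) : ℝ) / (cfNum α n : ℝ)) Filter.atTop)) ∧
      IsKAutomatic k (cfSeq (Filter.limsup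
      (fun n => (cfNum α (n + 1) : ℝ) / (cfNum α n : ℝ)) Filter.atTop)) := by
    have hP0 : cfNum α 0 = cfSeq α 0 := rfl
    have hP1 : cfNum α 1 = cfSeq α 1 * cfSeq α 0 + 1 := rfl
    have h1 : 1 ≤ cfSeq α 1 := ha1 0
    rcases le_or_gt 0 (cfSeq α 0) with h | h
    · have := mul_nonneg (zero_le_one.trans h1) h
      exact isKAutomatic_cfSeq_ratio hk ha ha1 (fun _ => rfl) (hP0 ▸ h) (by linarith) (by linarith)
    · have := isKAutomatic_cfSeq_ratio hk ha ha1 (P := fun n => -cfNum α n)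
        (fun n => by simp only [cfNum]; ring) (by linarith) (by nlinarith) (by nlinarith)
      simpa only [Int.cast_neg, neg_div_neg_eq] using this
  exact ⟨hnum.1, hden.1, hnum.2, hden.2⟩
end
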